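/- arXiv:0801.2996 — 2 statements merged into one kernel-verified Lean document; each statement's English description precedes it below -/
import Mathlib

section
/- For every t with 0 < t < 1, the function y ↦ f_t(y) is convex on ℝ: its second derivative satisfies f_t″(y) ≥ 0 for all real y. -/
open MeasureTheory Real Set

/-- Modified Bessel function of the third kind `K_w(a)` for `a > 0`:
`K_w(a) = ∫₀^∞ e^{−a·cosh u} · cosh(w·u) du`. -/
noncomputable def Kbes (a : ℝ) (w : ℂ) : ℂ :=
  ∫ u in Ioi (0:ℝ), Complex.exp (-(a:ℂ) * (Real.cosh u : ℂ)) * Complex.cosh (w * (u:ℂ))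

/-- `K_{iz}(a) = ∫₀^∞ e^{−a·cosh u} · cos(z·u) du`. -/
noncomputable def Kiz (a : ℝ) (z : ℂ) : ℂ :=
  ∫ u in Ioi (0:ℝ), Complex.exp (-(a:ℂ) * (Real.cosh u : ℂ)) * Complex.cos (z * (u:ℂ))

/-- The real-valued function `K_{ix}(a)` for real `x`. -/
noncomputable def Kre (a x : ℝ) : ℝ :=
  ∫ u in Ioi (0:ℝ), Real.exp (-a * Real.cosh u) * Real.cos (x * u)

/-- The series `∑_{k=0}^∞ ((y+1)_k)² (1−t)^k / (k!·(k+1)!) = ₂F₁(y+1,y+1;2;1−t)`. -/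
noncomputable def Sgauss (y t : ℝ) : ℝ :=
  ∑' k : ℕ, ((ascPochhammer ℝ k).eval (y + 1))^2 * (1 - t)^k /
    ((k.factorial : ℝ) * ((k+1).factorial : ℝ))

/-- `f_t(y) = y² · t^y · ₂F₁(y+1, y+1; 2; 1−t)`. -/
noncomputable def fPol (t y : ℝ) : ℝ := y^2 * t ^ y * Sgauss y t

/-- `F_{a,c}(z) = K_{i(z−ic)}(a) + K_{i(z+ic)}(a)`. -/
noncomputable def Fac (a c : ℝ) (z : ℂ) : ℂ :=
  Kbes a (Complex.I * (z - Complex.I * (c:ℂ))) + Kbes a (Complex.I * (z + Complex.I * (c:ℂ)))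

/-- Pólya's function `Ξ*(z) = 16π² ∫₀^∞ cosh(9u/2) e^{−2π cosh 2u} cos(zu) du`. -/
noncomputable def XiStar (z : ℂ) : ℂ :=
  16 * (Real.pi : ℂ)^2 * ∫ u in Ioi (0:ℝ),
    ((Real.cosh (9*u/2) * Real.exp (-(2*Real.pi) * Real.cosh (2*u)) : ℝ) : ℂ) *
      Complex.cos (z * (u:ℂ))

/-- `S(α, β; w) = ∑_{k=0}^∞ (α)_k (β)_k w^k / (k!·(k+1)!) = ₂F₁(α, β; 2; w)`. -/
noncomputable def S2gauss (α β w : ℝ) : ℝ :=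
  ∑' k : ℕ, (ascPochhammer ℝ k).eval α * (ascPochhammer ℝ k).eval β * w^k /
    ((k.factorial : ℝ) * ((k+1).factorial : ℝ))

/-- `g_{t,c}(y)`. -/
noncomputable def gPol (t c y : ℝ) : ℝ :=
  y*(y+2*c) * t ^ (y+c) * S2gauss (y+1) (y+2*c+1) (1-t)
  + y*(y-2*c) * t ^ (y-c) * S2gauss (y+1) (y-2*c+1) (1-t)
  - 2*y^2 * t ^ y * S2gauss (y+1) (y+1) (1-t)

/-- The power series of `₂F₁(y+1, y+1; 2; w)` in `w`. -/
noncomputable def gaussSeries (y : ℝ) : PowerSeries ℝ :=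
  PowerSeries.mk fun k => ((ascPochhammer ℝ k).eval (y + 1)) ^ 2 /
    ((k.factorial : ℝ) * ((k + 1).factorial : ℝ))

/-- The power series of `(1 - w) ^ y` in `w`. -/
noncomputable def oneSubRpowSeries (y : ℝ) : PowerSeries ℝ :=
  PowerSeries.mk fun k => (ascPochhammer ℝ k).eval (-y) / (k.factorial : ℝ)

/-- The coefficient of `w ^ n` in `(1 - w) ^ y * ₂F₁(y+1, y+1; 2; w)`. -/
noncomputable def evenCoeff (n : ℕ) (y : ℝ) : ℝ :=
  PowerSeries.coeff n (oneSubRpowSeries y * gaussSeries y)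

lemma coeff_gaussSeries_succ (y : ℝ) (k : ℕ) :
    (PowerSeries.coeff (k + 1) (gaussSeries y)) * ((k + 1) * (k + 2)) =
      (y + 1 + k) ^ 2 * PowerSeries.coeff k (gaussSeries y) := by
  have h : (k.factorial : ℝ) ≠ 0 := by positivity
  simp only [gaussSeries, PowerSeries.coeff_mk, ascPochhammer_succ_eval, Nat.factorial_succ]
  push_cast
  field_simp
  ring

lemma coeff_oneSubRpowSeries_succ (y : ℝ) (k : ℕ) :
    (PowerSeries.coeff (k + 1) (oneSubRpowSeries y)) * (k + 1) =
      (k - y) * PowerSeries.coeff k (oneSubRpowSeries y) := by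
  have h : (k.factorial : ℝ) ≠ 0 := by positivity
  simp only [oneSubRpowSeries, PowerSeries.coeff_mk, ascPochhammer_succ_eval, Nat.factorial_succ]
  push_cast
  field_simp
  ring

open PowerSeries in
/-- The binomial differential equation. -/
lemma oneSubRpowSeries_ode (y : ℝ) :
    (1 - X) * d⁄dX ℝ (oneSubRpowSeries y) = - C y * oneSubRpowSeries y := by
  ext n
  have h := coeff_oneSubRpowSeries_succ y n
  rw [sub_mul, one_mul, neg_mul]
  rcases n with _ | n
  · simp only [map_sub, map_neg, coeff_zero_X_mul, coeff_C_mul, coeff_derivative]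
    push_cast at h ⊢
    linear_combination h
  · simp only [map_sub, map_neg, coeff_succ_X_mul, coeff_C_mul, coeff_derivative]
    push_cast at h ⊢
    linarith

open PowerSeries in
/-- The hypergeometric differential equation. -/
lemma gaussSeries_ode (y : ℝ) :
    X * (1 - X) * d⁄dX ℝ (d⁄dX ℝ (gaussSeries y))
      + (2 - C (2 * y + 3) * X) * d⁄dX ℝ (gaussSeries y)
      - C ((y + 1) ^ 2) * gaussSeries y = 0 := by
  have e : X * (1 - X) * d⁄dX ℝ (d⁄dX ℝ (gaussSeries y))
      + (2 - C (2 * y + 3) * X) * d⁄dX ℝ (gaussSeries y)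
      - C ((y + 1) ^ 2) * gaussSeries y =
      X * d⁄dX ℝ (d⁄dX ℝ (gaussSeries y)) - X * (X * d⁄dX ℝ (d⁄dX ℝ (gaussSeries y)))
      + C 2 * d⁄dX ℝ (gaussSeries y) - C (2 * y + 3) * (X * d⁄dX ℝ (gaussSeries y))
      - C ((y + 1) ^ 2) * gaussSeries y := by
    rw [show (C (2 : ℝ) : PowerSeries ℝ) = 2 from map_ofNat _ 2]
    ring
  rw [e]
  ext n
  have h := coeff_gaussSeries_succ y n
  rcases n with _ | _ | n <;>
  · simp only [map_sub, map_add (coeff _), coeff_succ_X_mul, coeff_C_mul, coeff_derivative,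
      coeff_zero_X_mul, map_zero]
    push_cast at h ⊢
    linear_combination h

open PowerSeries in
/-- The differential equation of `(1 - w) ^ y * ₂F₁(y+1, y+1; 2; w)` involves only `y ^ 2`. -/
lemma oneSubRpowSeries_mul_gaussSeries_ode (y : ℝ) :
    X * (1 - X) ^ 2 * d⁄dX ℝ (d⁄dX ℝ (oneSubRpowSeries y * gaussSeries y))
      + (2 - 3 * X) * (1 - X) * d⁄dX ℝ (oneSubRpowSeries y * gaussSeries y)
      - (1 - X + C (y ^ 2)) * (oneSubRpowSeries y * gaussSeries y) = 0 := by
  have hT := oneSubRpowSeries_ode y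
  have hF := gaussSeries_ode y
  have hdT := congrArg (d⁄dX ℝ) hT
  simp only [Derivation.leibniz, map_neg, map_sub, Derivation.map_one_eq_zero, derivative_X,
    derivative_C, smul_eq_mul, map_add, map_mul, map_pow, map_one, map_ofNat] at hdT hF ⊢
  generalize oneSubRpowSeries y = T at *
  generalize gaussSeries y = F at *
  generalize d⁄dX ℝ (d⁄dX ℝ T) = ddT at *
  generalize d⁄dX ℝ (d⁄dX ℝ F) = ddF at *
  generalize d⁄dX ℝ T = dT at *
  generalize d⁄dX ℝ F = dF at *
  generalize (C y : PowerSeries ℝ) = c at *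
  linear_combination (1 - X) * T * hF + X * (1 - X) * F * hdT +
    (2 * X * (1 - X) * dF + (2 - 3 * X) * F + X * F - c * X * F) * hT

lemma evenCoeff_zero (y : ℝ) : evenCoeff 0 y = 1 := by
  simp [evenCoeff, oneSubRpowSeries, gaussSeries, PowerSeries.coeff_mul]

lemma evenCoeff_one (y : ℝ) : 2 * evenCoeff 1 y = 1 + y ^ 2 := by
  simp [evenCoeff, oneSubRpowSeries, gaussSeries, PowerSeries.coeff_mul,
    Finset.Nat.antidiagonal_succ]
  ring

open PowerSeries in
lemma evenCoeff_add_two (n : ℕ) (y : ℝ) :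
    (n + 2) * (n + 3) * evenCoeff (n + 2) y =
      ((2 * n + 3) * (n + 2) + y ^ 2) * evenCoeff (n + 1) y - (n + 1) ^ 2 * evenCoeff n y := by
  have h := oneSubRpowSeries_mul_gaussSeries_ode y
  simp only [evenCoeff]
  generalize oneSubRpowSeries y * gaussSeries y = G at *
  have e : X * d⁄dX ℝ (d⁄dX ℝ G) - C 2 * (X * (X * d⁄dX ℝ (d⁄dX ℝ G)))
      + X * (X * (X * d⁄dX ℝ (d⁄dX ℝ G))) + C 2 * d⁄dX ℝ G - C 5 * (X * d⁄dX ℝ G)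
      + C 3 * (X * (X * d⁄dX ℝ G)) - G + X * G - C (y ^ 2) * G = 0 := by
    rw [← h, show (C (2 : ℝ) : PowerSeries ℝ) = 2 from map_ofNat _ 2,
      show (C (3 : ℝ) : PowerSeries ℝ) = 3 from map_ofNat _ 3,
      show (C (5 : ℝ) : PowerSeries ℝ) = 5 from map_ofNat _ 5]
    ring
  have he := congrArg (coeff (n + 1)) e
  rcases n with _ | n
  · simp only [map_sub, map_add, coeff_succ_X_mul, coeff_C_mul, coeff_derivative,
      coeff_zero_X_mul, map_zero] at he ⊢
    push_cast at he ⊢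
    linear_combination he
  · rcases n with _ | n <;>
    · simp only [map_sub, map_add, coeff_succ_X_mul, coeff_C_mul, coeff_derivative,
        coeff_zero_X_mul, map_zero] at he ⊢
      push_cast at he ⊢
      linear_combination he

/-- The subtraction-free form of the recurrence. -/
lemma evenCoeff_succ (n : ℕ) (y : ℝ) :
    (n + 1) * (n + 2) * evenCoeff (n + 1) y = (n + 1) ^ 2 * evenCoeff n y +
      y ^ 2 * ∑ k ∈ Finset.range (n + 1), evenCoeff k y := by
  induction n with
  | zero =>
    have := evenCoeff_one y
    simp [evenCoeff_zero, this]
  | succ n ih =>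
    have := evenCoeff_add_two n y
    rw [Finset.sum_range_succ]
    push_cast
    linear_combination this + ih

/-- Nonnegative differentiable convex functions which are nondecreasing in `|y|`. -/
structure IsConvexInAbs (g : ℝ → ℝ) : Prop where
  convexOn : ConvexOn ℝ univ g
  differentiable : Differentiable ℝ g
  nonneg : ∀ y, 0 ≤ g y
  mono : ∀ y z, |y| ≤ |z| → g y ≤ g z

namespace IsConvexInAbs

variable {f g : ℝ → ℝ}

lemma const {c : ℝ} (hc : 0 ≤ c) : IsConvexInAbs fun _ => c :=
  ⟨convexOn_const c convex_univ, differentiable_const c, fun _ => hc, fun _ _ _ => le_rfl⟩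

lemma sq : IsConvexInAbs fun y => y ^ 2 :=
  ⟨even_two.convexOn_pow, by fun_prop, fun _ => sq_nonneg _, fun _ _ h => sq_le_sq.2 h⟩

lemma add (hf : IsConvexInAbs f) (hg : IsConvexInAbs g) : IsConvexInAbs fun y => f y + g y :=
  ⟨hf.convexOn.add hg.convexOn, hf.differentiable.add hg.differentiable,
    fun y => add_nonneg (hf.nonneg y) (hg.nonneg y),
    fun y z h => add_le_add (hf.mono y z h) (hg.mono y z h)⟩

lemma mul (hf : IsConvexInAbs f) (hg : IsConvexInAbs g) : IsConvexInAbs fun y => f y * g y where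
  convexOn := hf.convexOn.mul hg.convexOn (fun y _ => hf.nonneg y) (fun y _ => hg.nonneg y)
    fun y _ z _ h => hf.mono y z (le_of_not_ge fun hzy => (hg.mono z y hzy).not_gt h)
  differentiable := hf.differentiable.mul hg.differentiable
  nonneg y := mul_nonneg (hf.nonneg y) (hg.nonneg y)
  mono y z h := mul_le_mul (hf.mono y z h) (hg.mono y z h) (hg.nonneg y) (hf.nonneg z)

lemma sum {ι : Type*} (s : Finset ι) {f : ι → ℝ → ℝ} (hf : ∀ i ∈ s, IsConvexInAbs (f i)) :
    IsConvexInAbs fun y => ∑ i ∈ s, f i y := by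
  classical
  induction s using Finset.induction_on with
  | empty => simpa using const le_rfl
  | insert i s hi ih =>
    simp only [Finset.sum_insert hi]
    exact (hf i (by simp)).add (ih fun j hj => hf j (by simp [hj]))

lemma abs_deriv_le (hg : IsConvexInAbs g) {y R : ℝ} (hy : |y| ≤ R) :
    |deriv g y| ≤ g (R + 1) := by
  have hR : |R + 1| = R + 1 := abs_of_nonneg (by linarith [abs_nonneg y])
  obtain ⟨h₁, h₂⟩ := abs_le.1 hy
  have hu : deriv g y ≤ g (y + 1) - g y := by
    simpa [slope_def_field] using
      hg.convexOn.deriv_le_slope (mem_univ y) (mem_univ (y + 1)) (by linarith)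
        (hg.differentiable y)
  have hl : g y - g (y - 1) ≤ deriv g y := by
    simpa [slope_def_field] using
      hg.convexOn.slope_le_deriv (mem_univ (y - 1)) (mem_univ y) (by linarith)
        (hg.differentiable y)
  have hp := hg.mono (y + 1) (R + 1) (by rw [hR, abs_le]; constructor <;> linarith)
  have hm := hg.mono (y - 1) (R + 1) (by rw [hR, abs_le]; constructor <;> linarith)
  have := hg.nonneg y
  rw [abs_le]
  constructor <;> linarith

lemma convexOn_tsum {f : ℕ → ℝ → ℝ} (hf : ∀ n, IsConvexInAbs (f n))
    (hs : ∀ y, Summable fun n => f n y) : ConvexOn ℝ univ fun y => ∑' n, f n y := by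
  refine ⟨convex_univ, fun x _ y _ a b ha hb hab => ?_⟩
  simp only [smul_eq_mul]
  rw [← tsum_mul_left, ← tsum_mul_left,
    ← ((hs x).mul_left a).tsum_add ((hs y).mul_left b)]
  exact (hs _).tsum_le_tsum
    (fun n => (hf n).convexOn.2 (mem_univ x) (mem_univ y) ha hb hab)
    (((hs x).mul_left a).add ((hs y).mul_left b))

lemma differentiable_tsum {f : ℕ → ℝ → ℝ} (hf : ∀ n, IsConvexInAbs (f n))
    (hs : ∀ y, Summable fun n => f n y) : Differentiable ℝ fun y => ∑' n, f n y := by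
  intro y
  have hy : y ∈ Metric.ball (0 : ℝ) (|y| + 1) := by simp
  exact (hasDerivAt_tsum_of_isPreconnected (hs (|y| + 1 + 1)) Metric.isOpen_ball
    (convex_ball _ _).isPreconnected (fun n z _ => ((hf n).differentiable z).hasDerivAt)
    (fun n z hz => (hf n).abs_deriv_le (by simpa using (mem_ball_zero_iff.1 hz).le))
    hy (hs y) hy).differentiableAt

end IsConvexInAbs

lemma isConvexInAbs_evenCoeff (n : ℕ) : IsConvexInAbs (evenCoeff n) := by
  induction n using Nat.strong_induction_on with
  | _ n ih =>
    rcases n with _ | n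
    · rw [show evenCoeff 0 = fun _ => 1 from funext evenCoeff_zero]
      exact .const zero_le_one
    · have e : evenCoeff (n + 1) = fun y => (((n : ℝ) + 1) / (n + 2)) * evenCoeff n y +
          (1 / (((n : ℝ) + 1) * (n + 2))) *
            (y ^ 2 * ∑ k ∈ Finset.range (n + 1), evenCoeff k y) := by
        funext y
        have := evenCoeff_succ n y
        field_simp
        linear_combination this
      rw [e]
      exact ((IsConvexInAbs.const (by positivity)).mul (ih n n.lt_succ_self)).add
        ((IsConvexInAbs.const (by positivity)).mul
          (.mul .sq (.sum _ fun k hk => ih k (Finset.mem_range.1 hk))))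

lemma summable_norm_gaussSeries (y : ℝ) {w : ℝ} (hw : |w| < 1) :
    Summable fun k => ‖PowerSeries.coeff k (gaussSeries y) * w ^ k‖ := by
  obtain ⟨r, hwr, hr⟩ := exists_between hw
  have hlim : Filter.Tendsto (fun k : ℕ => |w| * ((y + 1 + (1 : ℝ) * k) / (1 + (1 : ℝ) * k) *
      ((y + 1 + (1 : ℝ) * k) / (2 + (1 : ℝ) * k)))) Filter.atTop (nhds (|w| * (1 / 1 * (1 / 1)))) :=
    ((tendsto_add_mul_div_add_mul_atTop_nhds _ _ _ one_ne_zero).mul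
      (tendsto_add_mul_div_add_mul_atTop_nhds _ _ _ one_ne_zero)).const_mul _
  rw [div_one, mul_one, mul_one] at hlim
  refine summable_of_ratio_norm_eventually_le (r := r) hr ?_
  filter_upwards [hlim.eventually_le_const hwr] with k hk
  have h := coeff_gaussSeries_succ y k
  have e : PowerSeries.coeff (k + 1) (gaussSeries y) =
      ((y + 1 + (1 : ℝ) * k) / (1 + (1 : ℝ) * k) * ((y + 1 + (1 : ℝ) * k) / (2 + (1 : ℝ) * k))) *
        PowerSeries.coeff k (gaussSeries y) := by
    have : (1 + (k : ℝ)) ≠ 0 := by positivity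
    have : (2 + (k : ℝ)) ≠ 0 := by positivity
    field_simp
    linear_combination h
  have hpos : 0 ≤ (y + 1 + (1 : ℝ) * k) / (1 + (1 : ℝ) * k) *
      ((y + 1 + (1 : ℝ) * k) / (2 + (1 : ℝ) * k)) := by
    rw [div_mul_div_comm, ← _root_.sq]
    positivity
  simp only [norm_norm]
  rw [e, pow_succ]
  simp only [norm_mul, Real.norm_eq_abs] at *
  rw [← abs_mul, abs_of_nonneg hpos]
  calc _ = (|w| * ((y + 1 + (1 : ℝ) * k) / (1 + (1 : ℝ) * k) *
      ((y + 1 + (1 : ℝ) * k) / (2 + (1 : ℝ) * k)))) *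
        (|PowerSeries.coeff k (gaussSeries y)| * |w ^ k|) := by ring
    _ ≤ _ := by gcongr

lemma hasSum_oneSubRpowSeries (y : ℝ) {w : ℝ} (hw : |w| < 1) :
    HasSum (fun k => PowerSeries.coeff k (oneSubRpowSeries y) * w ^ k) ((1 - w) ^ y) := by
  have h := (Real.one_div_one_sub_rpow_hasFPowerSeriesOnBall_zero (-y)).hasSum
    (y := w) (by simpa [enorm_eq_nnnorm] using! hw)
  have hpos : 0 ≤ 1 - w := by linarith [(abs_lt.1 hw).2]
  convert! h using 1
  · funext k
    have hm := Ring.factorial_nsmul_multichoose_eq_ascPochhammer (-y) k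
    rw [Polynomial.ascPochhammer_smeval_eq_eval, nsmul_eq_mul, Ring.multichoose_eq] at hm
    simp only [oneSubRpowSeries, PowerSeries.coeff_mk, ← hm]
    have : (k.factorial : ℝ) ≠ 0 := by positivity
    simp [FormalMultilinearSeries.ofScalars, this, mul_comm]
  · simp [Real.rpow_neg hpos]

lemma sum_antidiagonal_eq_evenCoeff (y w : ℝ) (n : ℕ) :
    ∑ kl ∈ Finset.HasAntidiagonal.antidiagonal n, (PowerSeries.coeff kl.1 (oneSubRpowSeries y) * w ^ kl.1) *
      (PowerSeries.coeff kl.2 (gaussSeries y) * w ^ kl.2) = evenCoeff n y * w ^ n := by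
  rw [evenCoeff, PowerSeries.coeff_mul, Finset.sum_mul]
  refine Finset.sum_congr rfl fun kl hkl => ?_
  rw [← Finset.HasAntidiagonal.mem_antidiagonal.1 hkl, pow_add]
  ring

lemma summable_evenCoeff (y : ℝ) {w : ℝ} (hw : |w| < 1) :
    Summable fun n => evenCoeff n y * w ^ n := by
  simpa only [sum_antidiagonal_eq_evenCoeff] using
    (summable_norm_sum_mul_antidiagonal_of_summable_norm
      (hasSum_oneSubRpowSeries y hw).summable.norm (summable_norm_gaussSeries y hw)).of_norm

lemma fPol_eq_tsum {t : ℝ} (ht : 0 < t) (ht1 : t < 1) (y : ℝ) :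
    fPol t y = ∑' n, (1 - t) ^ n * (y ^ 2 * evenCoeff n y) := by
  have hw : |1 - t| < 1 := by rw [abs_lt]; constructor <;> linarith
  have hb := hasSum_oneSubRpowSeries y hw
  have h := tsum_mul_tsum_eq_tsum_sum_antidiagonal_of_summable_norm
    hb.summable.norm (summable_norm_gaussSeries y hw)
  simp only [sum_antidiagonal_eq_evenCoeff, hb.tsum_eq, sub_sub_cancel] at h
  have hS : Sgauss y t = ∑' k, PowerSeries.coeff k (gaussSeries y) * (1 - t) ^ k :=
    tsum_congr fun k => by rw [gaussSeries, PowerSeries.coeff_mk, div_mul_eq_mul_div]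
  rw [fPol, hS, mul_assoc, h, ← tsum_mul_left]
  exact tsum_congr fun n => by ring

/-- `f_t` is convex on `ℝ` and its second derivative is nonnegative. -/
theorem fPol_convex (t : ℝ) (ht : 0 < t) (ht1 : t < 1) :
    ConvexOn ℝ Set.univ (fPol t) ∧ ∀ y : ℝ, 0 ≤ deriv (deriv (fPol t)) y := by
  have hw : |1 - t| < 1 := by rw [abs_lt]; constructor <;> linarith
  have hf : ∀ n, IsConvexInAbs fun y => (1 - t) ^ n * (y ^ 2 * evenCoeff n y) := fun n =>
    (IsConvexInAbs.const (pow_nonneg (by linarith) n)).mul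
      (IsConvexInAbs.sq.mul (isConvexInAbs_evenCoeff n))
  have hs : ∀ y, Summable fun n => (1 - t) ^ n * (y ^ 2 * evenCoeff n y) := fun y =>
    ((summable_evenCoeff y hw).mul_left (y ^ 2)).congr fun n => by ring
  rw [show fPol t = _ from funext (fPol_eq_tsum ht ht1)]
  have hc := IsConvexInAbs.convexOn_tsum hf hs
  have hd := IsConvexInAbs.differentiable_tsum hf hs
  exact ⟨hc, fun y => (monotoneOn_univ.1 (hc.monotoneOn_deriv fun x _ => hd x)).deriv_nonneg⟩
end

section
/- The entire function Ξ*(z) has only real zeros; that is, if Ξ*(z) = 0 for a complex number z, then Im z = 0. -/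
open MeasureTheory Real Set

open Filter Topology

/-- The Fourier cosine transform `∫ e^{-T cosh q} cos (x q) dq = 2 K_{ix}(T)`. -/
noncomputable def coshTransform (x T : ℝ) : ℝ :=
  ∫ q : ℝ, Real.exp (-T * Real.cosh q) * Real.cos (x * q)

lemma one_add_sq_half_le_cosh (u : ℝ) : 1 + u ^ 2 / 2 ≤ Real.cosh u := by
  wlog hu : 0 ≤ u generalizing u
  · simpa using this (-u) (by linarith)
  have h1 : u / 2 ≤ Real.sinh (u / 2) := Real.self_le_sinh_iff.2 (by linarith)
  have h2 : Real.cosh u = 1 + 2 * Real.sinh (u / 2) ^ 2 := by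
    have := Real.cosh_two_mul (u / 2)
    rw [Real.cosh_sq, mul_div_cancel₀ u two_ne_zero] at this
    linarith
  nlinarith

lemma integrable_exp_quadratic {b : ℝ} (hb : 0 < b) (s : ℝ) :
    Integrable fun u : ℝ => Real.exp (-b * u ^ 2 + s * u) := by
  have h := (integrable_cexp_quadratic' (b := ((-b : ℝ) : ℂ)) (by simpa using hb) (s : ℂ) 0).norm
  refine h.congr (ae_of_all _ fun u => ?_)
  simp only [Complex.norm_exp]
  congr 1
  simp [← Complex.ofReal_pow]

lemma integrable_exp_neg_mul_cosh_add {a : ℝ} (ha : 0 < a) (s : ℝ) :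
    Integrable fun u : ℝ => Real.exp (-a * Real.cosh u + s * u) := by
  refine (integrable_exp_quadratic (half_pos ha) s).mono' (by fun_prop) (ae_of_all _ fun u => ?_)
  rw [Real.norm_eq_abs, Real.abs_exp, Real.exp_le_exp]
  nlinarith [one_add_sq_half_le_cosh u]

lemma integrable_exp_neg_mul_cosh {a : ℝ} (ha : 0 < a) :
    Integrable fun u : ℝ => Real.exp (-a * Real.cosh u) := by
  simpa using integrable_exp_neg_mul_cosh_add ha 0

lemma integrable_coshTransform {T : ℝ} (hT : 0 < T) (x : ℝ) :
    Integrable fun q : ℝ => Real.exp (-T * Real.cosh q) * Real.cos (x * q) := by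
  refine (integrable_exp_neg_mul_cosh hT).mono' (by fun_prop) (ae_of_all _ fun q => ?_)
  rw [norm_mul, Real.norm_eq_abs, Real.abs_exp, Real.norm_eq_abs]
  exact mul_le_of_le_one_right (Real.exp_pos _).le (Real.abs_cos_le_one _)

lemma abs_coshTransform_le {T₀ T : ℝ} (hT₀ : 0 < T₀) (hT : T₀ ≤ T) (x : ℝ) :
    |coshTransform x T| ≤
      (∫ q : ℝ, Real.exp (-(T₀ / 2) * Real.cosh q)) * Real.exp (-T / 2) := by
  rw [← Real.norm_eq_abs, ← integral_mul_const]
  refine norm_integral_le_of_norm_le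
    ((integrable_exp_neg_mul_cosh (half_pos hT₀)).mul_const _) (ae_of_all _ fun q => ?_)
  rw [norm_mul, Real.norm_eq_abs, Real.abs_exp, Real.norm_eq_abs, ← Real.exp_add]
  refine (mul_le_of_le_one_right (Real.exp_pos _).le (Real.abs_cos_le_one _)).trans ?_
  rw [Real.exp_le_exp]
  nlinarith [Real.one_le_cosh q]

lemma measurable_coshTransform (x : ℝ) : Measurable (coshTransform x) := by
  refine (StronglyMeasurable.integral_prod_right (f := fun T q : ℝ =>
    Real.exp (-T * Real.cosh q) * Real.cos (x * q)) ?_).measurable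
  refine Continuous.stronglyMeasurable ?_
  simp only [Function.uncurry_def]
  fun_prop

lemma continuousAt_coshTransform {T : ℝ} (hT : 0 < T) (x : ℝ) :
    ContinuousAt (coshTransform x) T := by
  refine continuousAt_of_dominated (bound := fun q => Real.exp (-(T / 2) * Real.cosh q))
    (Eventually.of_forall fun _ => by fun_prop) ?_
    (integrable_exp_neg_mul_cosh (half_pos hT)) (ae_of_all _ fun _ => by fun_prop)
  filter_upwards [lt_mem_nhds (half_lt_self hT)] with S hS
  refine ae_of_all _ fun q => ?_
  rw [norm_mul, Real.norm_eq_abs, Real.abs_exp, Real.norm_eq_abs]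
  refine (mul_le_of_le_one_right (Real.exp_pos _).le (Real.abs_cos_le_one _)).trans ?_
  rw [Real.exp_le_exp]
  nlinarith [Real.one_le_cosh q]

lemma sq_le_self_mul_sinh (q : ℝ) : q ^ 2 ≤ q * Real.sinh q := by
  wlog hq : 0 ≤ q generalizing q
  · simpa using this (-q) (by linarith)
  nlinarith [Real.self_le_sinh_iff.2 hq]

lemma tendsto_self_mul_exp_neg_mul_cosh {T : ℝ} (hT : 0 < T) {l : Filter ℝ}
    (hl : Tendsto (fun q : ℝ => |q|) l atTop) :
    Tendsto (fun q : ℝ => q * Real.exp (-T * Real.cosh q)) l (𝓝 0) := by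
  have h1 : Tendsto (fun q : ℝ => (2 / T) * |q|⁻¹) l (𝓝 0) := by
    simpa using (tendsto_inv_atTop_zero.comp hl).const_mul (2 / T)
  refine squeeze_zero_norm' ?_ h1
  filter_upwards [hl.eventually_gt_atTop 0] with q hq
  rw [norm_mul, Real.norm_eq_abs, Real.norm_eq_abs, Real.abs_exp, neg_mul, Real.exp_neg,
    ← div_eq_mul_inv, div_le_iff₀ (Real.exp_pos _)]
  have h2 : T * q ^ 2 / 2 ≤ Real.exp (T * Real.cosh q) := by
    nlinarith [Real.add_one_le_exp (T * Real.cosh q), one_add_sq_half_le_cosh q]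
  rw [← sq_abs q] at h2
  calc |q| = 2 / T * |q|⁻¹ * (T * |q| ^ 2 / 2) := by field_simp
    _ ≤ _ := by gcongr

lemma integrable_sq_mul_exp_neg_mul_cosh {T : ℝ} (hT : 0 < T) :
    Integrable fun q : ℝ => q ^ 2 * Real.exp (-T * Real.cosh q) := by
  refine ((integrable_exp_neg_mul_cosh (half_pos hT)).const_mul (4 / T)).mono' (by fun_prop)
    (ae_of_all _ fun q => ?_)
  rw [Real.norm_eq_abs, abs_of_nonneg (by positivity)]
  have h1 : T / 4 * q ^ 2 ≤ Real.exp (T / 2 * Real.cosh q) := by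
    nlinarith [Real.add_one_le_exp (T / 2 * Real.cosh q), one_add_sq_half_le_cosh q]
  have h2 : Real.exp (-(T / 2) * Real.cosh q) =
      Real.exp (T / 2 * Real.cosh q) * Real.exp (-T * Real.cosh q) := by
    rw [← Real.exp_add]; ring_nf
  rw [h2, ← mul_assoc]
  gcongr
  calc q ^ 2 = 4 / T * (T / 4 * q ^ 2) := by field_simp
    _ ≤ _ := by gcongr

lemma integrable_self_mul_sinh_mul_exp_neg_mul_cosh {T : ℝ} (hT : 0 < T) :
    Integrable fun q : ℝ => q * Real.sinh q * Real.exp (-T * Real.cosh q) := by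
  have hb := ((integrable_exp_neg_mul_cosh_add hT 2).add
    (integrable_exp_neg_mul_cosh_add hT (-2)))
  refine hb.mono' (by fun_prop) (ae_of_all _ fun q => ?_)
  rw [norm_mul, Real.norm_eq_abs, Real.norm_eq_abs, Real.abs_exp, Pi.add_apply, Real.exp_add,
    Real.exp_add, ← mul_add, mul_comm]
  gcongr
  rw [abs_of_nonneg ((sq_nonneg q).trans (sq_le_self_mul_sinh q))]
  wlog hq : 0 ≤ q generalizing q
  · have := this (-q) (by linarith)
    simp only [Real.sinh_neg] at this
    ring_nf at this ⊢
    linarith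
  have h1 : q ≤ Real.exp q := by linarith [Real.add_one_le_exp q]
  have h2 : Real.sinh q ≤ Real.exp q := by
    linarith [Real.sinh_add_cosh q, Real.cosh_pos q]
  calc q * Real.sinh q ≤ Real.exp q * Real.exp q := by
        gcongr
    _ = Real.exp (2 * q) := by rw [← Real.exp_add]; ring_nf
    _ ≤ _ := le_add_of_nonneg_right (Real.exp_pos _).le

lemma mul_integral_sq_mul_exp_neg_mul_cosh_le {T : ℝ} (hT : 0 < T) :
    T * ∫ q : ℝ, q ^ 2 * Real.exp (-T * Real.cosh q) ≤ ∫ q : ℝ, Real.exp (-T * Real.cosh q) := by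
  have hI := (integrable_self_mul_sinh_mul_exp_neg_mul_cosh hT).const_mul T
  have hE := integrable_exp_neg_mul_cosh hT
  have h0 := integral_of_hasDerivAt_of_tendsto
    (f := fun q : ℝ => q * Real.exp (-T * Real.cosh q))
    (f' := fun q : ℝ => Real.exp (-T * Real.cosh q) -
      T * (q * Real.sinh q * Real.exp (-T * Real.cosh q)))
    (fun q => by
      have := (hasDerivAt_id q).mul (((Real.hasDerivAt_cosh q).const_mul (-T)).exp)
      refine this.congr_deriv ?_
      simp only [id]
      ring)
    (hE.sub hI)
    (tendsto_self_mul_exp_neg_mul_cosh hT tendsto_abs_atBot_atTop)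
    (tendsto_self_mul_exp_neg_mul_cosh hT tendsto_abs_atTop_atTop)
  rw [integral_sub hE hI, integral_const_mul] at h0
  have h1 : ∫ q : ℝ, q ^ 2 * Real.exp (-T * Real.cosh q) ≤
      ∫ q : ℝ, q * Real.sinh q * Real.exp (-T * Real.cosh q) :=
    integral_mono (integrable_sq_mul_exp_neg_mul_cosh hT)
      (integrable_self_mul_sinh_mul_exp_neg_mul_cosh hT) fun q => by
        dsimp only
        gcongr
        exact sq_le_self_mul_sinh q
  nlinarith

lemma coshTransform_pos {x T : ℝ} (hT : 0 < T) (hx : x ^ 2 < T) : 0 < coshTransform x T := by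
  have hE := integrable_exp_neg_mul_cosh hT
  have hS := (integrable_sq_mul_exp_neg_mul_cosh hT).const_mul (x ^ 2 / 2)
  have h1 : (∫ q : ℝ, Real.exp (-T * Real.cosh q)) -
      x ^ 2 / 2 * ∫ q : ℝ, q ^ 2 * Real.exp (-T * Real.cosh q) ≤ coshTransform x T := by
    rw [← integral_const_mul, ← integral_sub hE hS]
    refine integral_mono (hE.sub hS) (integrable_coshTransform hT x) fun q => ?_
    have := Real.one_sub_sq_div_two_le_cos (x := x * q)
    dsimp only
    nlinarith [Real.exp_pos (-T * Real.cosh q)]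
  have h2 : 0 < ∫ q : ℝ, Real.exp (-T * Real.cosh q) := integral_exp_pos hE
  have h3 : 0 ≤ ∫ q : ℝ, q ^ 2 * Real.exp (-T * Real.cosh q) :=
    integral_nonneg fun q => by positivity
  nlinarith [mul_integral_sq_mul_exp_neg_mul_cosh_le hT]

lemma integral_pi_div_add_mul_cos_sq {ζ : ℝ} (hζ : 0 < ζ) (r : ℝ) :
    ∫ θ in (-π)..π, ζ / (ζ ^ 2 + (r * Real.cos θ) ^ 2) = 2 * π / √(ζ ^ 2 + r ^ 2) := by
  set b := √(ζ ^ 2 + r ^ 2) with hb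
  have hb0 : 0 < b := Real.sqrt_pos.2 (by positivity)
  have hb2 : b ^ 2 = ζ ^ 2 + r ^ 2 := Real.sq_sqrt (by positivity)
  have hden : ∀ θ : ℝ, 0 < b * Real.cos θ ^ 2 + ζ * Real.sin θ ^ 2 := fun θ => by
    rcases le_total (Real.cos θ ^ 2) (1 / 2) with h | h
    · have : 0 < Real.sin θ ^ 2 := by nlinarith [Real.sin_sq_add_cos_sq θ]
      positivity
    · have : 0 < Real.cos θ ^ 2 := by linarith
      positivity
  have hder : ∀ θ : ℝ, HasDerivAt (fun θ : ℝ => (θ + Real.arctan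
      ((ζ - b) * Real.sin θ * Real.cos θ / (b * Real.cos θ ^ 2 + ζ * Real.sin θ ^ 2))) / b)
      (ζ / (ζ ^ 2 + (r * Real.cos θ) ^ 2)) θ := by
    intro θ
    have hn := ((Real.hasDerivAt_sin θ).const_mul (ζ - b)).mul (Real.hasDerivAt_cos θ)
    have hd := (((Real.hasDerivAt_cos θ).pow 2).const_mul b).add
      (((Real.hasDerivAt_sin θ).pow 2).const_mul ζ)
    have h := ((hasDerivAt_id θ).add ((hn.div hd (hden θ).ne').arctan)).div_const b
    refine h.congr_deriv ?_
    have h0 := hden θ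
    have hs : Real.sin θ ^ 2 = 1 - Real.cos θ ^ 2 := by
      linarith [Real.sin_sq_add_cos_sq θ]
    have hr : (r * Real.cos θ) ^ 2 = (b ^ 2 - ζ ^ 2) * Real.cos θ ^ 2 := by
      rw [hb2]; ring
    have hq : 0 < ζ ^ 2 + (r * Real.cos θ) ^ 2 := by positivity
    rw [hr] at hq ⊢
    have hsum : (b * Real.cos θ ^ 2 + ζ * Real.sin θ ^ 2) ^ 2 +
        ((ζ - b) * Real.sin θ * Real.cos θ) ^ 2 = ζ ^ 2 + (b ^ 2 - ζ ^ 2) * Real.cos θ ^ 2 := by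
      rw [mul_pow, mul_pow, hs]; ring
    have harctan : ∀ n d N : ℝ, 0 < d →
        1 / (1 + (n / d) ^ 2) * (N / d ^ 2) = N / (d ^ 2 + n ^ 2) := fun n d N hd => by
      field_simp
    simp only [Pi.add_apply, Pi.mul_apply, Pi.pow_apply, Pi.div_apply]
    rw [harctan _ _ _ h0, hsum]
    rw [div_eq_div_iff hb0.ne' hq.ne', add_mul, div_mul_cancel₀ _ hq.ne']
    push_cast
    linear_combination (ζ - b) * (-ζ * (Real.sin θ ^ 2 + 1 - Real.cos θ ^ 2) -
      (ζ - b) * Real.cos θ ^ 2) * hs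
  rw [intervalIntegral.integral_eq_sub_of_hasDerivAt (fun θ _ => hder θ)]
  · simp
    ring
  · refine Continuous.intervalIntegrable ?_ _ _
    refine continuous_const.div (by fun_prop) fun θ => ?_
    positivity

lemma integral_div_sqrt_eq_integral_mul_cosh (k : ℝ → ℝ) {τ : ℝ} (hτ : 0 < τ) :
    ∫ y : ℝ, k (√(τ ^ 2 + y ^ 2)) / √(τ ^ 2 + y ^ 2) = ∫ p : ℝ, k (τ * Real.cosh p) := by
  have h := integral_image_eq_integral_abs_deriv_smul (s := univ)
    (f := fun p => τ * Real.sinh p) (f' := fun p => τ * Real.cosh p) MeasurableSet.univ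
    (fun p _ => ((Real.hasDerivAt_sinh p).const_mul τ).hasDerivWithinAt)
    (fun p _ q _ hpq => Real.sinh_injective (mul_left_cancel₀ hτ.ne' hpq))
    (fun y => k (√(τ ^ 2 + y ^ 2)) / √(τ ^ 2 + y ^ 2))
  have himg : Set.image (fun p => τ * Real.sinh p) univ = univ := by
    rw [image_univ, range_eq_univ]
    intro y
    obtain ⟨p, hp⟩ := Real.sinh_surjective (y / τ)
    exact ⟨p, by simp only [hp]; field_simp⟩
  rw [himg, setIntegral_univ, setIntegral_univ] at h
  rw [h]
  congr 1 with p
  have hc := Real.cosh_pos p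
  have : √(τ ^ 2 + (τ * Real.sinh p) ^ 2) = τ * Real.cosh p := by
    rw [Real.sqrt_eq_iff_mul_self_eq (by positivity) (by positivity)]
    have := Real.cosh_sq p
    linear_combination (-τ ^ 2) * this
  rw [this, abs_of_pos (by positivity), smul_eq_mul]
  field_simp

/-- If every dilate `p ↦ k (τ cosh p)` with `τ ≥ 1` has nonnegative integral, then so does
`p ↦ k (cosh p)` over every half-line `p > P > 0`. -/
lemma integral_Ioi_comp_cosh_nonneg {k : ℝ → ℝ} {C : ℝ} (hm : Measurable k)
    (hc : ∀ t, 1 ≤ t → ContinuousAt k t) (hk : ∀ t, 1 ≤ t → |k t| ≤ C / t ^ 4)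
    (h0 : ∀ τ, 1 ≤ τ → 0 ≤ ∫ p : ℝ, k (τ * Real.cosh p)) {P : ℝ} (hP : 0 < P) :
    0 ≤ ∫ p in Ioi P, k (Real.cosh p) := by
  obtain ⟨ζ, hζ⟩ : ∃ ζ, ζ = Real.sinh P := ⟨_, rfl⟩
  have hζ0 : 0 < ζ := hζ ▸ Real.sinh_pos_iff.2 hP
  have hC : 0 ≤ C := by simpa using (abs_nonneg _).trans (hk 1 le_rfl)
  have hsq1 : ∀ ξ : ℝ, 0 ≤ ξ → 1 ≤ √(1 + ξ) := fun ξ hξ => by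
    rw [Real.one_le_sqrt]; linarith
  set E : ℝ → ℝ := fun ξ => k (√(1 + ξ)) / √(1 + ξ) with hE
  have hEm : Measurable E := (hm.comp (by fun_prop)).div (by fun_prop)
  have hEb : ∀ ξ, 0 ≤ ξ → |E ξ| ≤ C / (1 + ξ) ^ 2 := fun ξ hξ => by
    have h1 := hsq1 ξ hξ
    rw [hE, abs_div, abs_of_pos (show 0 < √(1 + ξ) by linarith)]
    refine (div_le_self (abs_nonneg _) h1).trans ((hk _ h1).trans_eq ?_)
    rw [show √(1 + ξ) ^ 4 = (√(1 + ξ) ^ 2) ^ 2 by ring, Real.sq_sqrt (by linarith)]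
  have hrb : ∀ r, 0 ≤ r → r * |E (ζ ^ 2 + r ^ 2)| ≤ C * (1 + r ^ 2)⁻¹ := fun r hr => by
    have h1 : (1 + r ^ 2) ^ 2 ≤ (1 + (ζ ^ 2 + r ^ 2)) ^ 2 := by
      gcongr; nlinarith
    calc r * |E (ζ ^ 2 + r ^ 2)| ≤ (1 + r ^ 2) * (C / (1 + r ^ 2) ^ 2) := by
          gcongr
          · nlinarith
          · exact (hEb _ (by positivity)).trans (by gcongr)
      _ = _ := by field_simp
  have hplane : 0 ≤ ∫ w : ℝ × ℝ, ζ / (ζ ^ 2 + w.1 ^ 2) * E (ζ ^ 2 + w.1 ^ 2 + w.2 ^ 2) := by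
    by_cases hi : Integrable fun w : ℝ × ℝ =>
        ζ / (ζ ^ 2 + w.1 ^ 2) * E (ζ ^ 2 + w.1 ^ 2 + w.2 ^ 2)
    · rw [Measure.volume_eq_prod] at hi ⊢
      rw [integral_prod _ hi]
      refine integral_nonneg fun v => ?_
      simp only [integral_const_mul, Pi.zero_apply]
      refine mul_nonneg (by positivity) ?_
      have h1 := hsq1 (ζ ^ 2 + v ^ 2) (by positivity)
      have h2 := integral_div_sqrt_eq_integral_mul_cosh k (lt_of_lt_of_le one_pos h1)
      rw [Real.sq_sqrt (by positivity)] at h2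
      simp only [hE, ← add_assoc] at h2 ⊢
      rw [h2]
      exact h0 _ (by simpa only [add_assoc] using h1)
    · rw [integral_undef hi]
  have hpolar : 0 ≤ ∫ r in Ioi (0 : ℝ), r * E (ζ ^ 2 + r ^ 2) * (2 * π / √(ζ ^ 2 + r ^ 2)) := by
    rw [← integral_comp_polarCoord_symm] at hplane
    have hcongr : ∀ w : ℝ × ℝ, w.1 • (ζ / (ζ ^ 2 + (polarCoord.symm w).1 ^ 2) *
        E (ζ ^ 2 + (polarCoord.symm w).1 ^ 2 + (polarCoord.symm w).2 ^ 2)) =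
        w.1 * E (ζ ^ 2 + w.1 ^ 2) * (ζ / (ζ ^ 2 + (w.1 * Real.cos w.2) ^ 2)) := fun w => by
      have : ζ ^ 2 + (w.1 * Real.cos w.2) ^ 2 + (w.1 * Real.sin w.2) ^ 2 = ζ ^ 2 + w.1 ^ 2 := by
        linear_combination w.1 ^ 2 * Real.sin_sq_add_cos_sq w.2
      simp only [polarCoord_symm_apply, this, smul_eq_mul]
      ring
    simp only [hcongr, polarCoord_target] at hplane
    have hint : IntegrableOn (fun w : ℝ × ℝ =>
        w.1 * E (ζ ^ 2 + w.1 ^ 2) * (ζ / (ζ ^ 2 + (w.1 * Real.cos w.2) ^ 2)))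
        (Ioi 0 ×ˢ Ioo (-π) π) (volume.prod volume) := by
      rw [IntegrableOn, ← Measure.prod_restrict]
      have hdom := Integrable.mul_prod (μ := volume.restrict (Ioi (0 : ℝ)))
        (ν := volume.restrict (Ioo (-π) π))
        ((integrable_inv_one_add_sq.const_mul C).integrableOn (s := Ioi (0 : ℝ)))
        (integrable_const (ζ⁻¹))
      refine hdom.mono' ?_ ?_
      · refine Measurable.aestronglyMeasurable ?_
        have := hEm.comp (show Measurable fun w : ℝ × ℝ => ζ ^ 2 + w.1 ^ 2 by fun_prop)
        exact (measurable_fst.mul this).mul (by fun_prop)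
      · rw [Measure.prod_restrict]
        filter_upwards [ae_restrict_mem (measurableSet_Ioi.prod measurableSet_Ioo)] with w hw
        have hw1 : 0 < w.1 := hw.1
        rw [Real.norm_eq_abs, abs_mul, abs_mul, abs_of_pos hw1,
          abs_of_pos (show 0 < ζ / (ζ ^ 2 + (w.1 * Real.cos w.2) ^ 2) by positivity)]
        have h2 : ζ / (ζ ^ 2 + (w.1 * Real.cos w.2) ^ 2) ≤ ζ⁻¹ := by
          rw [div_le_iff₀ (by positivity)]
          field_simp
          nlinarith [sq_nonneg (w.1 * Real.cos w.2)]
        exact mul_le_mul (hrb _ hw1.le) h2 (by positivity) (by positivity)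
    rw [Measure.volume_eq_prod, setIntegral_prod _ hint] at hplane
    simp only [integral_const_mul] at hplane
    simpa only [← integral_Ioc_eq_integral_Ioo, ← intervalIntegral.integral_of_le
      (neg_le_self Real.pi_pos.le), integral_pi_div_add_mul_cos_sq hζ0] using hplane
  have hgint : Integrable fun p => k (Real.cosh p) := by
    refine (integrable_inv_one_add_sq.const_mul (4 * C)).mono'
      (hm.comp Real.measurable_cosh).aestronglyMeasurable (ae_of_all _ fun p => ?_)
    refine (hk _ (Real.one_le_cosh p)).trans ?_
    have h1 : 1 + p ^ 2 ≤ 4 * Real.cosh p ^ 4 := by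
      have h2 := one_add_sq_half_le_cosh p
      have h3 : 1 * Real.cosh p ≤ Real.cosh p ^ 3 * Real.cosh p := by
        gcongr
        exact one_le_pow₀ (Real.one_le_cosh p)
      nlinarith [Real.one_le_cosh p]
    rw [← div_eq_mul_inv, div_le_div_iff₀ (by positivity) (by positivity)]
    nlinarith
  have hrw : ∀ r : ℝ, ((fun p => k (Real.cosh p)) ∘ fun r => Real.arsinh (√(ζ ^ 2 + r ^ 2))) r *
      ((√(1 + √(ζ ^ 2 + r ^ 2) ^ 2))⁻¹ * (r / √(ζ ^ 2 + r ^ 2))) =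
      (2 * π)⁻¹ * (r * E (ζ ^ 2 + r ^ 2) * (2 * π / √(ζ ^ 2 + r ^ 2))) := fun r => by
    have h2 : √(ζ ^ 2 + r ^ 2) ^ 2 = ζ ^ 2 + r ^ 2 := Real.sq_sqrt (by positivity)
    simp only [Function.comp, Real.cosh_arsinh, h2, hE]
    have := Real.pi_pos
    field_simp
  have hsub := integral_comp_mul_deriv_Ioi (a := 0) (g := fun p => k (Real.cosh p))
    (f := fun r => Real.arsinh (√(ζ ^ 2 + r ^ 2)))
    (f' := fun r => (√(1 + √(ζ ^ 2 + r ^ 2) ^ 2))⁻¹ * (r / √(ζ ^ 2 + r ^ 2)))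
    (Real.continuous_arsinh.comp (by fun_prop)).continuousOn ?_ ?_ ?_ hgint.integrableOn ?_
  · have hP' : Real.arsinh √(ζ ^ 2 + 0 ^ 2) = P := by
      rw [zero_pow two_ne_zero, add_zero, Real.sqrt_sq hζ0.le, hζ, Real.arsinh_sinh]
    rw [hP'] at hsub
    rw [← hsub]
    simp only [hrw, integral_const_mul]
    have := Real.pi_pos
    positivity
  · refine Real.sinhOrderIso.symm.tendsto_atTop.comp ?_
    refine Filter.tendsto_atTop_mono (fun r => ?_) tendsto_id
    exact (le_abs_self r).trans (Real.abs_le_sqrt (by nlinarith))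
  · intro r _
    have h1 : HasDerivAt (fun r : ℝ => ζ ^ 2 + r ^ 2) (2 * r) r := by
      simpa using (hasDerivAt_pow 2 r).const_add (ζ ^ 2)
    have h2 := (h1.sqrt (by positivity)).arsinh
    refine (h2.congr_deriv ?_).hasDerivWithinAt
    rw [smul_eq_mul]
    field_simp
  · exact fun p _ => ((hc _ (Real.one_le_cosh p)).comp
      (f := Real.cosh) Real.continuous_cosh.continuousAt).continuousWithinAt
  · simp only [hrw]
    refine Integrable.const_mul ?_ _
    have hdom := (integrable_inv_one_add_sq.const_mul C).mul_const (2 * π / ζ)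
    refine (hdom.integrableOn (s := Ici (0 : ℝ))).mono' ?_ ?_
    · refine Measurable.aestronglyMeasurable ?_
      have := hEm.comp (show Measurable fun r : ℝ => ζ ^ 2 + r ^ 2 by fun_prop)
      exact (measurable_id.mul this).mul (by fun_prop)
    · filter_upwards [ae_restrict_mem measurableSet_Ici] with r hr
      have hr0 : 0 ≤ r := hr
      have hpi := Real.pi_pos
      have h1 : ζ ≤ √(ζ ^ 2 + r ^ 2) := Real.le_sqrt_of_sq_le (by nlinarith)
      rw [Real.norm_eq_abs, abs_mul, abs_mul, abs_of_nonneg hr0,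
        abs_of_nonneg (show 0 ≤ 2 * π / √(ζ ^ 2 + r ^ 2) by positivity)]
      exact mul_le_mul (hrb r hr0) (by gcongr) (by positivity) (by positivity)

lemma integral_eq_integral_Ioi_add_neg {E : Type*} [NormedAddCommGroup E] [NormedSpace ℝ E]
    {f : ℝ → E} (hf : Integrable f) : ∫ x, f x = ∫ x in Ioi (0 : ℝ), (f x + f (-x)) := by
  rw [integral_add hf.integrableOn hf.comp_neg.integrableOn, integral_comp_neg_Ioi, neg_zero,
    add_comm, intervalIntegral.integral_Iic_add_Ioi hf.integrableOn hf.integrableOn]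

/-- The two-sided Laplace transform of `e^{-a cosh 2u}`. -/
noncomputable def coshLaplace (a : ℝ) (ν : ℂ) : ℂ :=
  ∫ u : ℝ, Complex.exp (-(a : ℂ) * (Real.cosh (2 * u) : ℂ) + ν * u)

lemma norm_cexp_neg_mul_cosh_add (a : ℝ) (ν : ℂ) (u : ℝ) :
    ‖Complex.exp (-(a : ℂ) * (Real.cosh (2 * u) : ℂ) + ν * u)‖ =
      Real.exp (-a * Real.cosh (2 * u) + ν.re * u) := by
  rw [Complex.norm_exp, ← Complex.ofReal_neg, ← Complex.ofReal_mul, Complex.add_re,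
    Complex.ofReal_re, Complex.re_mul_ofReal]

lemma integrable_coshLaplace {a : ℝ} (ha : 0 < a) (ν : ℂ) :
    Integrable fun u : ℝ => Complex.exp (-(a : ℂ) * (Real.cosh (2 * u) : ℂ) + ν * u) := by
  have h := (integrable_exp_neg_mul_cosh_add ha (ν.re / 2)).comp_mul_left' (two_ne_zero)
  refine h.mono' (by fun_prop) (ae_of_all _ fun u => ?_)
  rw [norm_cexp_neg_mul_cosh_add]
  exact le_of_eq (by ring_nf)

lemma conj_coshLaplace (a : ℝ) (ν : ℂ) :
    (starRingEnd ℂ) (coshLaplace a ν) = coshLaplace a ((starRingEnd ℂ) ν) := by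
  rw [coshLaplace, ← integral_conj]
  simp only [← Complex.exp_conj, map_add, map_mul, map_neg, Complex.conj_ofReal]
  rfl

lemma cosh_add_cosh_sub (p t : ℝ) :
    Real.cosh (2 * t) + Real.cosh (2 * (p - t)) =
      2 * Real.cosh p * Real.cosh (2 * t - p) := by
  have h1 := Real.cosh_add p (2 * t - p)
  have h2 := Real.cosh_sub p (2 * t - p)
  rw [show p + (2 * t - p) = 2 * t by ring] at h1
  rw [show p - (2 * t - p) = 2 * (p - t) by ring] at h2
  linarith

lemma integrable_exp_mul_coshTransform {T₀ : ℝ} (hT₀ : 0 < T₀) (s x : ℝ) :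
    Integrable fun p : ℝ => Real.exp (s * p) * coshTransform x (T₀ * Real.cosh p) := by
  have h := (integrable_exp_neg_mul_cosh_add (half_pos hT₀) s).const_mul
    (∫ q : ℝ, Real.exp (-(T₀ / 2) * Real.cosh q))
  refine h.mono' ?_ (ae_of_all _ fun p => ?_)
  · exact (Measurable.mul (by fun_prop)
      ((measurable_coshTransform x).comp (by fun_prop))).aestronglyMeasurable
  · rw [norm_mul, Real.norm_eq_abs, Real.abs_exp, Real.norm_eq_abs, Real.exp_add]
    have h1 := abs_coshTransform_le hT₀
      (le_mul_of_one_le_right hT₀.le (Real.one_le_cosh p)) x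
    refine (mul_le_mul_of_nonneg_left h1 (Real.exp_pos (s * p)).le).trans_eq ?_
    ring_nf

lemma normSq_coshLaplace {a : ℝ} (ha : 0 < a) (s x : ℝ) :
    Complex.normSq (coshLaplace a (s + x * Complex.I)) =
      2⁻¹ * ∫ p : ℝ, Real.exp (s * p) * coshTransform x (2 * a * Real.cosh p) := by
  have hconj : (starRingEnd ℂ) (s + x * Complex.I : ℂ) = s - x * Complex.I := by simp; ring
  have hconv := integral_convolution (μ := volume) (ν := volume) (ContinuousLinearMap.mul ℝ ℂ)
    (integrable_coshLaplace ha (s + x * Complex.I)) (integrable_coshLaplace ha (s - x * Complex.I))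
  have hinner : ∀ p : ℝ, (convolution
      (fun u : ℝ => Complex.exp (-(a : ℂ) * (Real.cosh (2 * u) : ℂ) + (s + x * Complex.I) * u))
      (fun u : ℝ => Complex.exp (-(a : ℂ) * (Real.cosh (2 * u) : ℂ) + (s - x * Complex.I) * u))
      (ContinuousLinearMap.mul ℝ ℂ) volume p).re =
      2⁻¹ * (Real.exp (s * p) * coshTransform x (2 * a * Real.cosh p)) := fun p => by
    set Φ : ℝ → ℂ := fun q => Complex.exp
      (s * p - ((2 * a * Real.cosh p * Real.cosh q : ℝ) : ℂ) + x * q * Complex.I) with hΦ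
    have h1 : ∀ t : ℝ,
        Complex.exp (-(a : ℂ) * (Real.cosh (2 * t) : ℂ) + (s + x * Complex.I) * t) *
        Complex.exp (-(a : ℂ) * (Real.cosh (2 * (p - t)) : ℂ) +
          (s - x * Complex.I) * ((p - t : ℝ) : ℂ)) = Φ (2 * t - p) := fun t => by
      rw [hΦ, ← Complex.exp_add]
      congr 1
      have := congrArg (fun r : ℝ => (r : ℂ)) (cosh_add_cosh_sub p t)
      push_cast at this ⊢
      linear_combination (-(a : ℂ)) * this
    have hre : ∀ q, (Φ q).re =
        Real.exp (s * p) * (Real.exp (-(2 * a * Real.cosh p) * Real.cosh q) * Real.cos (x * q)) :=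
      fun q => by
        rw [hΦ, Complex.exp_re, ← mul_assoc, ← Real.exp_add]
        congr 2
        · simp [Complex.cosh_ofReal_re]; ring
        · simp
    have hn : ∀ q, ‖Φ q‖ =
        Real.exp (s * p) * Real.exp (-(2 * a * Real.cosh p) * Real.cosh q) := fun q => by
      rw [hΦ, Complex.norm_exp, ← Real.exp_add]
      congr 1
      simp [Complex.cosh_ofReal_re]; ring
    have hΦi : Integrable Φ := by
      have hpos : 0 < 2 * a * Real.cosh p := mul_pos (by linarith) (Real.cosh_pos p)
      refine ((integrable_exp_neg_mul_cosh hpos).const_mul (Real.exp (s * p))).mono' ?_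
        (ae_of_all _ fun q => (hn q).le)
      exact (by fun_prop : Continuous Φ).aestronglyMeasurable
    simp only [convolution_def, ContinuousLinearMap.mul_apply', h1]
    rw [Measure.integral_comp_mul_left (fun y => Φ (y - p)) 2, integral_sub_right_eq_self,
      Complex.smul_re, ← Complex.reCLM_apply, ← Complex.reCLM.integral_comp_comm hΦi]
    simp only [Complex.reCLM_apply, hre, integral_const_mul, smul_eq_mul, coshTransform]
    norm_num
  have hprod : ((Complex.normSq (coshLaplace a (s + x * Complex.I)) : ℝ) : ℂ) =
      coshLaplace a (s + x * Complex.I) * coshLaplace a (s - x * Complex.I) := by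
    rw [← Complex.mul_conj, conj_coshLaplace, hconj]
  have hci := (integrable_coshLaplace ha (s + x * Complex.I)).integrable_convolution
    (ContinuousLinearMap.mul ℝ ℂ) (integrable_coshLaplace ha (s - x * Complex.I))
  rw [ContinuousLinearMap.mul_apply', ← coshLaplace, ← coshLaplace, ← hprod] at hconv
  rw [← Complex.ofReal_re (Complex.normSq _), ← hconv, ← Complex.reCLM_apply,
    ← Complex.reCLM.integral_comp_comm hci]
  simp only [Complex.reCLM_apply, hinner, integral_const_mul]

lemma integral_exp_mul_coshTransform {T₀ : ℝ} (hT₀ : 0 < T₀) (s x : ℝ) :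
    ∫ p : ℝ, Real.exp (s * p) * coshTransform x (T₀ * Real.cosh p) =
      2 * ∫ p in Ioi (0 : ℝ), Real.cosh (s * p) * coshTransform x (T₀ * Real.cosh p) := by
  rw [integral_eq_integral_Ioi_add_neg (integrable_exp_mul_coshTransform hT₀ s x),
    ← integral_const_mul]
  congr 1 with p
  rw [Real.cosh_neg, Real.cosh_eq (s * p), mul_neg]
  ring

lemma integral_coshTransform_comp_cosh_nonneg {T : ℝ} (hT : 0 < T) (x : ℝ) :
    0 ≤ ∫ p : ℝ, coshTransform x (T * Real.cosh p) := by
  have h := normSq_coshLaplace (half_pos hT) 0 x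
  have h1 := Complex.normSq_nonneg (coshLaplace (T / 2) ((0 : ℝ) + x * Complex.I))
  rw [h] at h1
  simp only [zero_mul, Real.exp_zero, one_mul, mul_div_cancel₀ T two_ne_zero] at h1
  linarith

lemma integral_Ioi_coshTransform_comp_cosh_nonneg {T₀ : ℝ} (hT₀ : 0 < T₀) (x : ℝ) {P : ℝ}
    (hP : 0 < P) : 0 ≤ ∫ p in Ioi P, coshTransform x (T₀ * Real.cosh p) := by
  set D := ∫ q : ℝ, Real.exp (-(T₀ / 2) * Real.cosh q)
  have hD : 0 ≤ D := integral_nonneg fun q => (Real.exp_pos _).le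
  refine integral_Ioi_comp_cosh_nonneg (k := fun t => coshTransform x (T₀ * t))
    (C := D * (24 * (2 / T₀) ^ 4)) ((measurable_coshTransform x).comp (by fun_prop)) ?_ ?_ ?_ hP
  · intro t ht
    exact (continuousAt_coshTransform (x := x) (T := T₀ * t) (by positivity)).comp
      (f := fun t => T₀ * t) (by fun_prop)
  · intro t ht
    have ht0 : 0 < t := by linarith
    refine (abs_coshTransform_le hT₀ (le_mul_of_one_le_right hT₀.le ht) x).trans ?_
    rw [mul_div_assoc]
    gcongr
    have h1 := Real.pow_div_factorial_le_exp (T₀ * t / 2) (by positivity) 4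
    rw [neg_div, Real.exp_neg]
    refine (inv_anti₀ (by positivity) h1).trans_eq ?_
    norm_num [Nat.factorial]
    field_simp
  · intro τ hτ
    simpa only [mul_assoc] using
      integral_coshTransform_comp_cosh_nonneg (T := T₀ * τ) (by positivity) x

/-- Integration by parts against a function with nonnegative tail integrals. -/
lemma integral_cosh_sub_cosh_mul_pos {κ : ℝ → ℝ} {C s₁ s₂ P₀ : ℝ} (hs₁ : 0 ≤ s₁) (hs : s₁ < s₂)
    (hκ : Continuous κ) (hb : ∀ p, 0 ≤ p → |κ p| ≤ C * Real.exp (-(s₂ + 1) * p))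
    (hT : ∀ P, 0 < P → 0 ≤ ∫ p in Ioi P, κ p) (hP₀ : 0 ≤ P₀) (hpos : ∀ p, P₀ < p → 0 < κ p) :
    0 < ∫ p in Ioi (0 : ℝ), (Real.cosh (s₂ * p) - Real.cosh (s₁ * p)) * κ p := by
  have hs₂ : 0 < s₂ := hs₁.trans_lt hs
  have hC : 0 ≤ C := by simpa using (abs_nonneg _).trans (hb 0 le_rfl)
  have hexp : ∀ P : ℝ, IntegrableOn (fun p => C * Real.exp (-(s₂ + 1) * p)) (Ioi P) := fun P =>
    (integrableOn_exp_mul_Ioi (by linarith) P).const_mul C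
  have hi : ∀ P, 0 ≤ P → IntegrableOn κ (Ioi P) := fun P hP =>
    (hexp P).mono' hκ.aestronglyMeasurable (by
      filter_upwards [ae_restrict_mem measurableSet_Ioi] with p hp
      exact hb p (hP.trans (le_of_lt hp)))
  have hTb : ∀ P, 0 ≤ P → |∫ p in Ioi P, κ p| ≤ C * Real.exp (-(s₂ + 1) * P) := fun P hP => by
    have h1 : ‖∫ p in Ioi P, κ p‖ ≤ ∫ p in Ioi P, C * Real.exp (-(s₂ + 1) * p) :=
      norm_integral_le_of_norm_le (hexp P) (by
        filter_upwards [ae_restrict_mem measurableSet_Ioi] with p hp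
        exact hb p (hP.trans (le_of_lt hp)))
    refine h1.trans ?_
    rw [integral_const_mul, integral_exp_mul_Ioi (by linarith)]
    gcongr
    rw [neg_div_neg_eq]
    exact div_le_self (Real.exp_pos _).le (by linarith)
  have hder : ∀ P ∈ Ioi (0 : ℝ), HasDerivAt (fun P => -∫ p in Ioi P, κ p) (κ P) P := by
    intro P hP
    have h1 : HasDerivAt (fun P => (∫ p in (0 : ℝ)..P, κ p) - ∫ p in Ioi 0, κ p) (κ P) P :=
      (intervalIntegral.integral_hasDerivAt_right (hκ.intervalIntegrable _ _)
        (hκ.stronglyMeasurableAtFilter _ _) hκ.continuousAt).sub_const _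
    refine h1.congr_of_eventuallyEq ?_
    filter_upwards [lt_mem_nhds hP] with Q hQ
    have := intervalIntegral.integral_interval_add_Ioi (hi 0 le_rfl) (hi Q hQ.le)
    linarith
  have hu : ∀ p ∈ Ioi (0 : ℝ), HasDerivAt (fun p => Real.cosh (s₂ * p) - Real.cosh (s₁ * p))
      (s₂ * Real.sinh (s₂ * p) - s₁ * Real.sinh (s₁ * p)) p := fun p _ => by
    have h := fun s : ℝ => ((hasDerivAt_id p).const_mul s).cosh
    refine ((h s₂).sub (h s₁)).congr_deriv ?_
    simp; ring
  have hmono : ∀ p, 0 ≤ p → s₁ * p ≤ s₂ * p := fun p hp => by gcongr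
  have hub : ∀ p, 0 ≤ p → |Real.cosh (s₂ * p) - Real.cosh (s₁ * p)| ≤ Real.exp (s₂ * p) := by
    intro p hp
    have h1 : Real.cosh (s₁ * p) ≤ Real.cosh (s₂ * p) := by
      rw [Real.cosh_le_cosh, abs_of_nonneg (by positivity), abs_of_nonneg (by positivity)]
      exact hmono p hp
    have h2 := Real.sinh_nonneg_iff.2 (show 0 ≤ s₂ * p by positivity)
    rw [abs_of_nonneg (by linarith)]
    linarith [Real.cosh_add_sinh (s₂ * p), Real.cosh_pos (s₁ * p)]
  have hu'0 : ∀ p, 0 < p → 0 < s₂ * Real.sinh (s₂ * p) - s₁ * Real.sinh (s₁ * p) := by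
    intro p hp
    have h1 : Real.sinh (s₁ * p) ≤ Real.sinh (s₂ * p) := Real.sinh_le_sinh.2 (hmono p hp.le)
    have h2 : 0 < Real.sinh (s₂ * p) := Real.sinh_pos_iff.2 (by positivity)
    nlinarith
  have hu'b : ∀ p, 0 < p → |s₂ * Real.sinh (s₂ * p) - s₁ * Real.sinh (s₁ * p)| ≤
      s₂ * Real.exp (s₂ * p) := by
    intro p hp
    have h1 := Real.sinh_nonneg_iff.2 (show 0 ≤ s₁ * p by positivity)
    rw [abs_of_pos (hu'0 p hp)]
    nlinarith [Real.cosh_add_sinh (s₂ * p), Real.cosh_pos (s₂ * p), mul_nonneg hs₁ h1]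
  have hexp1 : ∀ p, Real.exp (s₂ * p) * (C * Real.exp (-(s₂ + 1) * p)) = C * Real.exp (-p) := by
    intro p
    rw [mul_left_comm, ← Real.exp_add]
    ring_nf
  have hdecay : IntegrableOn (fun p => C * Real.exp (-p)) (Ioi 0) :=
    (integrableOn_exp_neg_Ioi 0).const_mul C
  have huκ : IntegrableOn (fun p => (Real.cosh (s₂ * p) - Real.cosh (s₁ * p)) * κ p) (Ioi 0) := by
    refine hdecay.mono' (by fun_prop) ?_
    filter_upwards [ae_restrict_mem measurableSet_Ioi] with p hp
    have hp0 : 0 ≤ p := le_of_lt hp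
    rw [norm_mul, ← hexp1]
    exact mul_le_mul (hub p hp0) (hb p hp0) (abs_nonneg _) (Real.exp_pos _).le
  have hTm : AEStronglyMeasurable (fun P => -∫ p in Ioi P, κ p) (volume.restrict (Ioi 0)) :=
    ContinuousOn.aestronglyMeasurable
      (fun P hP => (hder P hP).continuousAt.continuousWithinAt) measurableSet_Ioi
  have hu'T : IntegrableOn (fun P => (s₂ * Real.sinh (s₂ * P) - s₁ * Real.sinh (s₁ * P)) *
      -∫ p in Ioi P, κ p) (Ioi 0) := by
    refine (hdecay.const_mul s₂).mono' (AEStronglyMeasurable.mul (by fun_prop) hTm) ?_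
    filter_upwards [ae_restrict_mem measurableSet_Ioi] with p hp
    have hp0 : 0 < p := hp
    rw [norm_mul, norm_neg, ← hexp1, ← mul_assoc]
    exact mul_le_mul (hu'b p hp0) (hTb p hp0.le) (abs_nonneg _) (by positivity)
  have huTb : ∀ P, 0 ≤ P → ‖(Real.cosh (s₂ * P) - Real.cosh (s₁ * P)) * -∫ p in Ioi P, κ p‖ ≤
      |Real.cosh (s₂ * P) - Real.cosh (s₁ * P)| * C := fun P hP => by
    rw [norm_mul, norm_neg]
    refine mul_le_mul_of_nonneg_left ((hTb P hP).trans (mul_le_of_le_one_right hC ?_))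
      (abs_nonneg _)
    rw [Real.exp_le_one_iff]
    nlinarith
  have hparts := integral_Ioi_mul_deriv_eq_deriv_mul (a' := 0) (b' := 0) hu hder huκ hu'T ?_ ?_
  · rw [hparts, sub_zero, zero_sub, ← integral_neg]
    simp only [mul_neg, neg_neg]
    rw [setIntegral_pos_iff_support_of_nonneg_ae]
    · refine lt_of_lt_of_le ?_ (measure_mono (s := Ioi P₀) fun P hP => ⟨?_, hP₀.trans_lt hP⟩)
      · simp
      · have hP0 : 0 < P := hP₀.trans_lt hP
        refine (mul_pos (hu'0 P hP0) ?_).ne'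
        rw [setIntegral_pos_iff_support_of_nonneg_ae]
        · refine lt_of_lt_of_le ?_ (measure_mono (s := Ioi P) fun p hp =>
            ⟨(hpos p (lt_trans hP hp)).ne', hp⟩)
          simp
        · filter_upwards [ae_restrict_mem measurableSet_Ioi] with p hp
          exact (hpos p (lt_trans hP hp)).le
        · exact hi P hP0.le
    · filter_upwards [ae_restrict_mem measurableSet_Ioi] with P hP
      exact mul_nonneg (hu'0 P hP).le (hT P hP)
    · simpa using hu'T.neg
  · have h0 : Tendsto (fun P => |Real.cosh (s₂ * P) - Real.cosh (s₁ * P)| * C) (𝓝[>] 0) (𝓝 0) := by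
      have : Continuous fun P => |Real.cosh (s₂ * P) - Real.cosh (s₁ * P)| * C := by fun_prop
      exact (this.tendsto' 0 0 (by simp)).mono_left nhdsWithin_le_nhds
    refine squeeze_zero_norm' ?_ h0
    filter_upwards [self_mem_nhdsWithin] with P hP
    exact huTb P (le_of_lt hP)
  · have h0 : Tendsto (fun P => C * Real.exp (-P)) atTop (𝓝 0) := by
      simpa using Real.tendsto_exp_neg_atTop_nhds_zero.const_mul C
    refine squeeze_zero_norm' ?_ h0
    filter_upwards [eventually_ge_atTop 0] with P hP
    rw [Pi.mul_apply, norm_mul, norm_neg, ← hexp1]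
    exact mul_le_mul (hub P hP) (hTb P hP) (abs_nonneg _) (Real.exp_pos _).le

lemma exists_abs_coshTransform_comp_cosh_le {T₀ : ℝ} (hT₀ : 0 < T₀) (b x : ℝ) :
    ∃ C, ∀ p : ℝ, |coshTransform x (T₀ * Real.cosh p)| ≤ C * Real.exp (-b * p) := by
  set D := ∫ q : ℝ, Real.exp (-(T₀ / 2) * Real.cosh q)
  have hD : 0 ≤ D := integral_nonneg fun q => (Real.exp_pos _).le
  refine ⟨D * Real.exp (b ^ 2 / T₀), fun p => ?_⟩
  refine (abs_coshTransform_le hT₀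
    (le_mul_of_one_le_right hT₀.le (Real.one_le_cosh p)) x).trans ?_
  rw [mul_assoc, ← Real.exp_add]
  gcongr
  have h1 : b ^ 2 / T₀ + -b * p + T₀ * p ^ 2 / 4 = (T₀ * p / 2 - b) ^ 2 / T₀ := by
    field_simp; ring
  have h2 : 0 ≤ (T₀ * p / 2 - b) ^ 2 / T₀ := by positivity
  nlinarith [one_add_sq_half_le_cosh p]

/-- The modulus of `coshLaplace a` strictly increases along horizontal half-lines going away from
the imaginary axis. -/
lemma normSq_coshLaplace_lt {a : ℝ} (ha : 0 < a) {s₁ s₂ : ℝ} (hs : |s₁| < |s₂|) (x : ℝ) :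
    Complex.normSq (coshLaplace a (s₁ + x * Complex.I)) <
      Complex.normSq (coshLaplace a (s₂ + x * Complex.I)) := by
  have hT₀ : 0 < 2 * a := by linarith
  have hform : ∀ s : ℝ, Complex.normSq (coshLaplace a (s + x * Complex.I)) =
      ∫ p in Ioi (0 : ℝ), Real.cosh (|s| * p) * coshTransform x (2 * a * Real.cosh p) := by
    intro s
    rw [normSq_coshLaplace ha, integral_exp_mul_coshTransform hT₀, inv_mul_cancel_left₀ two_ne_zero]
    refine setIntegral_congr_fun measurableSet_Ioi fun p hp => ?_
    rw [← Real.cosh_abs (s * p), abs_mul, abs_of_pos (show 0 < p from hp)]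
  have hint : ∀ s : ℝ, IntegrableOn
      (fun p => Real.cosh (s * p) * coshTransform x (2 * a * Real.cosh p)) (Ioi 0) := by
    intro s
    have h := ((integrable_exp_mul_coshTransform hT₀ s x).add
      (integrable_exp_mul_coshTransform hT₀ (-s) x)).const_mul 2⁻¹
    refine (h.congr (ae_of_all _ fun p => ?_)).integrableOn
    simp only [Pi.add_apply, Real.cosh_eq, neg_mul]
    ring
  obtain ⟨C, hC⟩ := exists_abs_coshTransform_comp_cosh_le hT₀ (|s₂| + 1) x
  have hκ : Continuous fun p => coshTransform x (2 * a * Real.cosh p) :=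
    continuous_iff_continuousAt.2 fun p =>
      (continuousAt_coshTransform (mul_pos hT₀ (Real.cosh_pos p)) x).comp
        (f := fun p => 2 * a * Real.cosh p) (by fun_prop)
  have hpos := integral_cosh_sub_cosh_mul_pos (abs_nonneg s₁) hs hκ (fun p _ => hC p)
    (fun P hP => integral_Ioi_coshTransform_comp_cosh_nonneg hT₀ x hP)
    (P₀ := x ^ 2 / a) (by positivity) (fun p hp => by
      refine coshTransform_pos (mul_pos hT₀ (Real.cosh_pos p)) ?_
      have hp0 : 0 < p := lt_of_le_of_lt (by positivity) hp
      rw [div_lt_iff₀ ha] at hp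
      nlinarith [one_add_sq_half_le_cosh p, sq_nonneg (p - 1)])
  simp only [sub_mul] at hpos
  rw [integral_sub (hint _) (hint _), ← hform, ← hform] at hpos
  linarith

lemma XiStar_eq_coshLaplace (z : ℂ) :
    XiStar z = 4 * (π : ℂ) ^ 2 * (coshLaplace (2 * π) (9 / 2 + Complex.I * z) +
      coshLaplace (2 * π) (9 / 2 - Complex.I * z)) := by
  have hi := fun ν => integrable_coshLaplace (a := 2 * π) (by positivity) ν
  have hsum : ∀ ν, coshLaplace (2 * π) ν = ∫ u in Ioi (0 : ℝ),
      (Complex.exp (-((2 * π : ℝ) : ℂ) * (Real.cosh (2 * u) : ℂ) + ν * u) +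
        Complex.exp (-((2 * π : ℝ) : ℂ) * (Real.cosh (2 * u) : ℂ) - ν * u)) := fun ν => by
    rw [coshLaplace, integral_eq_integral_Ioi_add_neg (hi ν)]
    congr 1 with u
    simp [sub_eq_add_neg]
  have hsi : ∀ ν, IntegrableOn (fun u : ℝ =>
      (Complex.exp (-((2 * π : ℝ) : ℂ) * (Real.cosh (2 * u) : ℂ) + ν * u) +
        Complex.exp (-((2 * π : ℝ) : ℂ) * (Real.cosh (2 * u) : ℂ) - ν * u))) (Ioi 0) := fun ν => by
    refine ((hi ν).add (hi (-ν))).integrableOn.congr (ae_of_all _ fun u => ?_)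
    simp [sub_eq_add_neg]
  rw [hsum, hsum, ← integral_add (hsi _) (hsi _), XiStar, ← integral_const_mul,
    ← integral_const_mul]
  congr 1 with u
  push_cast
  rw [Complex.cosh, Complex.cos]
  simp only [sub_eq_add_neg, Complex.exp_add]
  have h9 : (9 : ℂ) * u / 2 = 9 / 2 * u := by ring
  have e : ∀ A B : ℂ, Complex.exp ((A + B) * u) = Complex.exp (A * u) * Complex.exp (B * u) :=
    fun A B => by rw [add_mul, Complex.exp_add]
  have e' : ∀ A B : ℂ,
      Complex.exp (-((A + B) * u)) = Complex.exp (-A * u) * Complex.exp (-B * u) :=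
    fun A B => by rw [← Complex.exp_add]; ring_nf
  rw [e, e, e', e', h9, show -(9 / 2 * (u : ℂ)) = -(9 / 2) * u by ring,
    show z * u * Complex.I = Complex.I * z * u by ring,
    show -(z * u) * Complex.I = -(Complex.I * z) * u by ring, neg_neg]
  ring

/-- Pólya's function `Ξ*` has only real zeros. -/
theorem XiStar_zeros_real (z : ℂ) (hz : XiStar z = 0) : z.im = 0 := by
  by_contra hy
  have ha : 0 < 2 * π := by positivity
  rw [XiStar_eq_coshLaplace, mul_eq_zero, or_iff_right (by simp [Real.pi_ne_zero])] at hz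
  have h1 : (9 / 2 + Complex.I * z : ℂ) = ((9 / 2 - z.im : ℝ) : ℂ) + z.re * Complex.I := by
    apply Complex.ext <;> simp
    norm_num; ring
  have h2 : (9 / 2 - Complex.I * z : ℂ) =
      (starRingEnd ℂ) (((9 / 2 + z.im : ℝ) : ℂ) + z.re * Complex.I) := by
    rw [map_add, map_mul, Complex.conj_ofReal, Complex.conj_ofReal, Complex.conj_I]
    apply Complex.ext <;> simp
  rw [h1, h2, ← conj_coshLaplace] at hz
  have hn := congrArg Complex.normSq (eq_neg_of_add_eq_zero_left hz)
  rw [Complex.normSq_neg, Complex.normSq_conj] at hn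
  rcases lt_or_gt_of_ne hy with h | h
  · refine (normSq_coshLaplace_lt ha (s₁ := 9 / 2 + z.im) (s₂ := 9 / 2 - z.im) ?_ z.re).ne hn.symm
    rw [← sq_lt_sq]; nlinarith
  · refine (normSq_coshLaplace_lt ha (s₁ := 9 / 2 - z.im) (s₂ := 9 / 2 + z.im) ?_ z.re).ne hn
    rw [← sq_lt_sq]; nlinarith
end
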